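/- Let H = (H_n = (V_n,E_n))_{n∈ℕ} be a sequence of k-uniform hypergraphs, let p = (p_n)_{n∈ℕ} ∈ (0,1)^ℕ with p_n^k|E_n| → ∞ as n → ∞, and let α ≥ 0 and K ≥ 1 be such that H is α-dense and (K,p)-bounded. Then for every i ∈ [k], δ > 0, and sequence (ω_n)_{n∈ℕ} with ω_n → ∞, there exist ξ > 0, b > 0, C ≥ 1, and n₀ such that for all β, γ ∈ (0,1] with βγ ≥ α+δ, every n ≥ n₀, and every q with 1/ω_n ≥ q ≥ C·p_n the following holds: if U ⊆ V_n with |U| ≥ β|V_n|, then with probability at least 1 − 2^{−b·q·|V_n|} the binomial random subset U_q satisfies: for every subset W ⊆ U_q with |W| ≥ γ|U_q| we have |E_U^i(W)| ≥ ξ·q^i·|E_n|. -/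

import Mathlib

open Finset Filter

/-- The probability weight of obtaining exactly the subset `S` when each element of the
finite ground set `Γ` is included independently with probability `p`. -/
noncomputable def binomWeight {α : Type*} (Γ : Finset α) (p : ℝ) (S : Finset α) : ℝ :=
  p ^ S.card * (1 - p) ^ (Γ.card - S.card)

open Classical in
/-- The probability that the binomial random subset `Γ_p` satisfies the property `P`. -/
noncomputable def binomProb {α : Type*} (Γ : Finset α) (p : ℝ) (P : Finset α → Prop) : ℝ :=
  ∑ S ∈ Γ.powerset, if P S then binomWeight Γ p S else 0

/-- `deg_i(v, U)`: the number of edges `e` of the hypergraph with edge set `E` such that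
`v ∈ e` and `|e ∩ (U \ {v})| ≥ i`. -/
def degi {α : Type*} [DecidableEq α] (E : Finset (Finset α)) (i : ℕ) (v : α) (U : Finset α) : ℕ :=
  (E.filter fun e => v ∈ e ∧ i ≤ (e ∩ U.erase v).card).card

/-- `μ_i(H, q)`: the expected value of `∑_{v ∈ V} deg_i(v, V_q)²` for the binomial random
subset `V_q` of the vertex set `V` of the hypergraph `H = (V, E)`. -/
noncomputable def mu {α : Type*} [DecidableEq α] (V : Finset α) (E : Finset (Finset α))
    (i : ℕ) (q : ℝ) : ℝ :=
  ∑ S ∈ V.powerset, binomWeight V q S * ∑ v ∈ V, (degi E i v S : ℝ) ^ 2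

/-- A sequence of hypergraphs `(V n, E n)` is `α`-dense. -/
def AlphaDense {α : Type*} [DecidableEq α] (V : ℕ → Finset α) (E : ℕ → Finset (Finset α))
    (a : ℝ) : Prop :=
  ∀ ε : ℝ, 0 < ε → ∃ ζ : ℝ, 0 < ζ ∧ ∃ n₀ : ℕ, ∀ n ≥ n₀, ∀ U ⊆ V n,
    (a + ε) * ((V n).card : ℝ) ≤ (U.card : ℝ) →
    ζ * ((E n).card : ℝ) ≤ (((E n).filter fun e => e ⊆ U).card : ℝ)

/-- A sequence of `k`-uniform hypergraphs `(V n, E n)` is `(K, p)`-bounded. -/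
def KPBounded {α : Type*} [DecidableEq α] (k : ℕ) (V : ℕ → Finset α)
    (E : ℕ → Finset (Finset α)) (K : ℝ) (p : ℕ → ℝ) : Prop :=
  ∀ i : ℕ, 1 ≤ i → i ≤ k - 1 → ∃ n₀ : ℕ, ∀ n ≥ n₀, ∀ q : ℝ, p n ≤ q → q ≤ 1 →
    mu (V n) (E n) i q ≤ K * q ^ (2 * i) * ((E n).card : ℝ) ^ 2 / ((V n).card : ℝ)

/-- `|E_U^i(W)|`: the number of edges of the hypergraph induced on `U` having at least `i`
vertices in `W`. -/
def edgeCountIn {α : Type*} [DecidableEq α] (E : Finset (Finset α)) (U W : Finset α)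
    (i : ℕ) : ℕ :=
  (E.filter fun e => e ⊆ U ∧ i ≤ (e ∩ W).card).card

/-- The expected value of `f` on the binomial random subset `Γ_p`. -/
noncomputable def binomExp {α : Type*} (Γ : Finset α) (p : ℝ) (f : Finset α → ℝ) : ℝ :=
  ∑ S ∈ Γ.powerset, binomWeight Γ p S * f S

section Probability

variable {α : Type*}

lemma binomWeight_nonneg {q : ℝ} (h0 : 0 ≤ q) (h1 : q ≤ 1) (U S : Finset α) :
    0 ≤ binomWeight U q S :=
  mul_nonneg (pow_nonneg h0 _) (pow_nonneg (sub_nonneg.2 h1) _)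

lemma binomProb_eq_binomExp (U : Finset α) (q : ℝ) (P : Finset α → Prop) [DecidablePred P] :
    binomProb U q P = binomExp U q (fun S => if P S then 1 else 0) := by
  simp only [binomProb, binomExp, mul_ite, mul_one, mul_zero]
  exact Finset.sum_congr rfl fun S _ => by split_ifs <;> rfl

lemma binomExp_mono {q : ℝ} (h0 : 0 ≤ q) (h1 : q ≤ 1) {U : Finset α} {f g : Finset α → ℝ}
    (h : ∀ S ⊆ U, f S ≤ g S) : binomExp U q f ≤ binomExp U q g :=
  Finset.sum_le_sum fun S hS =>
    mul_le_mul_of_nonneg_left (h S (mem_powerset.1 hS)) (binomWeight_nonneg h0 h1 U S)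

lemma binomExp_congr {q : ℝ} {U : Finset α} {f g : Finset α → ℝ}
    (h : ∀ S ⊆ U, f S = g S) : binomExp U q f = binomExp U q g :=
  Finset.sum_congr rfl fun S hS => by rw [h S (mem_powerset.1 hS)]

lemma binomExp_add (U : Finset α) (q : ℝ) (f g : Finset α → ℝ) :
    binomExp U q (fun S => f S + g S) = binomExp U q f + binomExp U q g := by
  simp [binomExp, mul_add, Finset.sum_add_distrib]

lemma binomExp_const_mul (U : Finset α) (q c : ℝ) (f : Finset α → ℝ) :
    binomExp U q (fun S => c * f S) = c * binomExp U q f := by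
  simp only [binomExp, Finset.mul_sum]
  exact Finset.sum_congr rfl fun _ _ => by ring

lemma binomExp_sum {ι : Type*} (J : Finset ι) (U : Finset α) (q : ℝ) (f : ι → Finset α → ℝ) :
    binomExp U q (fun S => ∑ j ∈ J, f j S) = ∑ j ∈ J, binomExp U q (f j) := by
  simp only [binomExp, Finset.mul_sum]
  exact Finset.sum_comm

lemma binomExp_pow (U : Finset α) (q x : ℝ) :
    binomExp U q (fun S => x ^ S.card) = (q * x + (1 - q)) ^ U.card := by
  rw [← Finset.sum_pow_mul_eq_add_pow]
  refine Finset.sum_congr rfl fun S _ => ?_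
  rw [binomWeight, mul_pow]; ring

lemma binomExp_const (U : Finset α) (q c : ℝ) : binomExp U q (fun _ => c) = c := by
  have := binomExp_pow U q 1
  have h := binomExp_const_mul U q c (fun _ => 1)
  simp at this h
  rw [h, this, mul_one]

lemma binomExp_nonneg {q : ℝ} (h0 : 0 ≤ q) (h1 : q ≤ 1) {U : Finset α} {f : Finset α → ℝ}
    (h : ∀ S ⊆ U, 0 ≤ f S) : 0 ≤ binomExp U q f :=
  (binomExp_const U q 0).symm.le.trans (binomExp_mono h0 h1 h)

lemma binomProb_mono {q : ℝ} (h0 : 0 ≤ q) (h1 : q ≤ 1) {U : Finset α} {P Q : Finset α → Prop}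
    (h : ∀ S ⊆ U, P S → Q S) : binomProb U q P ≤ binomProb U q Q := by
  classical
  rw [binomProb_eq_binomExp, binomProb_eq_binomExp]
  refine binomExp_mono h0 h1 fun S hS => ?_
  have := h S hS
  split_ifs <;> simp_all

lemma binomProb_le_one {q : ℝ} (h0 : 0 ≤ q) (h1 : q ≤ 1) (U : Finset α) (P : Finset α → Prop) :
    binomProb U q P ≤ 1 := by
  classical
  rw [binomProb_eq_binomExp]
  refine (binomExp_mono h0 h1 fun S hS => ?_).trans_eq (binomExp_const U q 1)
  split_ifs <;> norm_num

lemma binomProb_not (U : Finset α) (q : ℝ) (P : Finset α → Prop) :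
    binomProb U q P = 1 - binomProb U q (fun S => ¬ P S) := by
  classical
  rw [eq_sub_iff_add_eq, binomProb_eq_binomExp, binomProb_eq_binomExp, ← binomExp_add]
  refine (binomExp_congr fun S _ => ?_).trans (binomExp_const U q 1)
  by_cases h : P S <;> simp [h]

lemma binomProb_or_le {q : ℝ} (h0 : 0 ≤ q) (h1 : q ≤ 1) (U : Finset α) (P Q : Finset α → Prop) :
    binomProb U q (fun S => P S ∨ Q S) ≤ binomProb U q P + binomProb U q Q := by
  classical
  simp only [binomProb_eq_binomExp]
  rw [← binomExp_add]
  refine binomExp_mono h0 h1 fun S _ => ?_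
  by_cases h : P S <;> by_cases h' : Q S <;> simp [h, h']

lemma binomProb_exists_le {ι : Type*} {q : ℝ} (h0 : 0 ≤ q) (h1 : q ≤ 1) (J : Finset ι)
    (U : Finset α) (P : ι → Finset α → Prop) :
    binomProb U q (fun S => ∃ j ∈ J, P j S) ≤ ∑ j ∈ J, binomProb U q (P j) := by
  classical
  simp only [binomProb_eq_binomExp]
  rw [← binomExp_sum]
  refine binomExp_mono h0 h1 fun S _ => ?_
  split_ifs with h
  · obtain ⟨j, hj, hP⟩ := h
    refine le_trans ?_ (Finset.single_le_sum (f := fun j => if P j S then (1 : ℝ) else 0)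
      (fun j _ => by split_ifs <;> norm_num) hj)
    simp [hP]
  · exact Finset.sum_nonneg fun j _ => by split_ifs <;> norm_num

/-- Markov's inequality. -/
lemma mul_binomProb_le_binomExp {q : ℝ} (h0 : 0 ≤ q) (h1 : q ≤ 1) {U : Finset α}
    {f : Finset α → ℝ} (hf : ∀ S ⊆ U, 0 ≤ f S) (c : ℝ) {P : Finset α → Prop}
    (hP : ∀ S ⊆ U, P S → c ≤ f S) : c * binomProb U q P ≤ binomExp U q f := by
  classical
  rw [binomProb_eq_binomExp, ← binomExp_const_mul]
  refine binomExp_mono h0 h1 fun S hS => ?_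
  split_ifs with h
  · simpa using hP S hS h
  · simpa using hf S hS

variable [DecidableEq α]

lemma binomExp_insert {x : α} {U : Finset α} (hx : x ∉ U) (q : ℝ) (f : Finset α → ℝ) :
    binomExp (insert x U) q f =
      (1 - q) * binomExp U q f + q * binomExp U q (fun S => f (insert x S)) := by
  simp only [binomExp]
  rw [Finset.sum_powerset_insert hx, Finset.mul_sum, Finset.mul_sum]
  congr 1
  · refine Finset.sum_congr rfl fun S hS => ?_
    have := card_le_card (mem_powerset.1 hS)
    rw [binomWeight, binomWeight, card_insert_of_notMem hx, Nat.sub_add_comm this, pow_succ]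
    ring
  · refine Finset.sum_congr rfl fun S hS => ?_
    have hxS : x ∉ S := fun h => hx (mem_powerset.1 hS h)
    rw [binomWeight, binomWeight, card_insert_of_notMem hx, card_insert_of_notMem hxS,
      Nat.add_sub_add_right, pow_succ]
    ring

lemma binomExp_inter {A U : Finset α} (hA : A ⊆ U) (q : ℝ) (f : Finset α → ℝ) :
    binomExp U q (fun S => f (S ∩ A)) = binomExp A q f := by
  obtain ⟨B, rfl, hAB⟩ : ∃ B, U = B ∪ A ∧ Disjoint B A :=
    ⟨U \ A, (Finset.sdiff_union_of_subset hA).symm, Finset.sdiff_disjoint⟩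
  clear hA
  induction B using Finset.induction_on with
  | empty =>
    refine (congrArg (fun X => binomExp X q _) (empty_union A)).trans
      (binomExp_congr fun S hS => ?_)
    rw [inter_eq_left.2 hS]
  | insert x B hx ih =>
    rw [disjoint_insert_left] at hAB
    rw [insert_union, binomExp_insert (by simp [hx, hAB.1])]
    simp only [insert_inter_of_notMem hAB.1]
    rw [ih hAB.2]; ring

lemma binomProb_inter {A U : Finset α} (hA : A ⊆ U) (q : ℝ) (P : Finset α → Prop) :
    binomProb U q (fun S => P (S ∩ A)) = binomProb A q P := by
  classical
  rw [binomProb_eq_binomExp, binomProb_eq_binomExp, ← binomExp_inter hA]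

lemma binomExp_superset {F U : Finset α} (hF : F ⊆ U) (q : ℝ) (f : Finset α → ℝ) :
    binomExp U q (fun S => if F ⊆ S then f (S \ F) else 0) =
      q ^ F.card * binomExp (U \ F) q f := by
  simp only [binomExp, mul_ite, mul_zero]
  rw [← Finset.sum_filter, Finset.mul_sum]
  refine Finset.sum_bij' (fun S _ => S \ F) (fun T _ => T ∪ F) ?_ ?_ ?_ ?_ ?_
  · intro S hS
    simp only [mem_filter, mem_powerset] at hS ⊢
    exact sdiff_subset_sdiff hS.1 le_rfl
  · intro T hT
    simp only [mem_filter, mem_powerset] at hT ⊢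
    exact ⟨union_subset (hT.trans sdiff_subset) hF, subset_union_right⟩
  · intro S hS
    simp only [mem_filter, mem_powerset] at hS
    exact sdiff_union_of_subset hS.2
  · intro T hT
    simp only [mem_powerset] at hT
    exact union_sdiff_cancel_right (disjoint_of_subset_left hT sdiff_disjoint)
  · intro S hS
    simp only [mem_filter, mem_powerset] at hS
    have h1 := card_sdiff_add_card_eq_card hS.2
    have h2 := card_sdiff_add_card_eq_card hF
    have h3 : U.card - S.card = (U \ F).card - (S \ F).card := by omega
    rw [binomWeight, binomWeight, h3, ← h1, pow_add]
    ring

/-- Exposing a binomial random subset in two rounds. -/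
lemma binomExp_two_round (U : Finset α) {q c q₁ q₂ : ℝ} (h₁ : q₁ = c * q)
    (h₂ : (1 - q₁) * q₂ = q * (1 - c)) (f : Finset α → Finset α → ℝ) :
    binomExp U q (fun S => binomExp S c (fun S₁ => f S₁ (S \ S₁))) =
      binomExp U q₁ (fun S₁ => binomExp (U \ S₁) q₂ (fun T => f S₁ T)) := by
  have h₃ : (1 - q₁) * (1 - q₂) = 1 - q := by rw [mul_sub, h₂, h₁]; ring
  simp only [binomExp, Finset.mul_sum]
  rw [Finset.sum_sigma', Finset.sum_sigma']
  refine Finset.sum_bij' (fun x _ => ⟨x.2, x.1 \ x.2⟩) (fun x _ => ⟨x.1 ∪ x.2, x.1⟩) ?_ ?_ ?_ ?_ ?_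
  · rintro ⟨S, S₁⟩ h
    simp only [mem_sigma, mem_powerset] at h ⊢
    exact ⟨h.2.trans h.1, sdiff_subset_sdiff h.1 le_rfl⟩
  · rintro ⟨S₁, T⟩ h
    simp only [mem_sigma, mem_powerset] at h ⊢
    exact ⟨union_subset h.1 (h.2.trans sdiff_subset), subset_union_left⟩
  · rintro ⟨S, S₁⟩ h
    simp only [mem_sigma, mem_powerset] at h
    simp [union_sdiff_of_subset h.2]
  · rintro ⟨S₁, T⟩ h
    simp only [mem_sigma, mem_powerset] at h
    simp only [Sigma.mk.injEq, heq_eq_eq, true_and]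
    exact union_sdiff_cancel_left (disjoint_of_subset_right h.2 disjoint_sdiff)
  · rintro ⟨S, S₁⟩ h
    simp only [mem_sigma, mem_powerset] at h
    have e1 := card_sdiff_add_card_eq_card h.2
    have e2 := card_sdiff_add_card_eq_card h.1
    have e3 := card_sdiff_add_card_eq_card (h.2.trans h.1)
    obtain ⟨x, hx⟩ : ∃ x, (S \ S₁).card = x := ⟨_, rfl⟩
    obtain ⟨y, hy⟩ : ∃ y, (U \ S).card = y := ⟨_, rfl⟩
    obtain ⟨z, hz⟩ : ∃ z, S₁.card = z := ⟨_, rfl⟩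
    have a1 : S.card = x + z := by omega
    have a2 : U.card = y + x + z := by omega
    have a3 : (U \ S₁).card = y + x := by omega
    simp only [binomWeight, a1, a2, a3, hx, hz]
    rw [show y + x + z - (x + z) = y by omega, show x + z - z = x by omega,
      show y + x + z - z = y + x by omega, show y + x - x = y by omega, ← h₃]
    have e4 : q ^ x * (1 - c) ^ x = (1 - q₁) ^ x * q₂ ^ x := by
      rw [← mul_pow, ← mul_pow, h₂]
    have e5 : q₁ ^ z = c ^ z * q ^ z := by rw [h₁, mul_pow]
    rw [e5, mul_pow, pow_add, pow_add]
    linear_combination (q ^ z * c ^ z * (1 - q₁) ^ y * (1 - q₂) ^ y * f S₁ (S \ S₁)) * e4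

lemma binomExp_exp_inter_le {q : ℝ} (h0 : 0 ≤ q) (h1 : q ≤ 1) {A U : Finset α} (hA : A ⊆ U)
    {t : ℝ} (ht : |t| ≤ 1) :
    binomExp U q (fun S => Real.exp (t * (S ∩ A).card)) ≤
      Real.exp (q * A.card * (t + t ^ 2)) := by
  rw [binomExp_inter hA q (fun S => Real.exp (t * S.card))]
  have : ∀ S : Finset α, Real.exp (t * S.card) = Real.exp t ^ S.card := fun S => by
    rw [mul_comm, Real.exp_nat_mul]
  simp only [this]
  rw [binomExp_pow]
  have h2 := (abs_le.1 (Real.abs_exp_sub_one_sub_id_le ht)).2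
  have h3 : q * Real.exp t + (1 - q) ≤ Real.exp (q * (t + t ^ 2)) := by
    refine le_trans ?_ (Real.add_one_le_exp _)
    nlinarith
  refine (pow_le_pow_left₀ (by have := Real.exp_pos t; nlinarith) h3 _).trans_eq ?_
  rw [← Real.exp_nat_mul]; ring_nf

/-- Chernoff's bound for the upper tail. -/
lemma binomProb_upper_tail {q : ℝ} (h0 : 0 ≤ q) (h1 : q ≤ 1) {A U : Finset α} (hA : A ⊆ U)
    {N τ : ℝ} (hN : A.card ≤ N) (hτ0 : 0 ≤ τ) (hτ1 : τ ≤ 1) :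
    binomProb U q (fun S => q * A.card + τ * (q * N) ≤ (S ∩ A).card) ≤
      Real.exp (-(τ ^ 2 / 4 * (q * N))) := by
  have hE := binomExp_exp_inter_le h0 h1 hA (t := τ / 2) (by rw [abs_le]; constructor <;> linarith)
  have hM := mul_binomProb_le_binomExp h0 h1 (U := U)
    (f := fun S => Real.exp (τ / 2 * (S ∩ A).card)) (fun _ _ => (Real.exp_pos _).le)
    (Real.exp (τ / 2 * (q * A.card + τ * (q * N))))
    (P := fun S => q * A.card + τ * (q * N) ≤ (S ∩ A).card)
    (fun S _ hS => Real.exp_le_exp.2 (mul_le_mul_of_nonneg_left hS (by linarith)))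
  have h3 := hM.trans hE
  rw [mul_comm, ← le_div_iff₀ (Real.exp_pos _), ← Real.exp_sub] at h3
  refine h3.trans (Real.exp_le_exp.2 ?_)
  have := mul_le_mul_of_nonneg_left hN (mul_nonneg h0 (sq_nonneg τ))
  nlinarith

/-- Chernoff's bound for the lower tail. -/
lemma binomProb_lower_tail {q : ℝ} (h0 : 0 ≤ q) (h1 : q ≤ 1) {A U : Finset α} (hA : A ⊆ U)
    {N τ : ℝ} (hN : A.card ≤ N) (hτ0 : 0 ≤ τ) (hτ1 : τ ≤ 1) :
    binomProb U q (fun S => ((S ∩ A).card : ℝ) ≤ q * A.card - τ * (q * N)) ≤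
      Real.exp (-(τ ^ 2 / 4 * (q * N))) := by
  have hE := binomExp_exp_inter_le h0 h1 hA (t := -(τ / 2))
    (by rw [abs_le]; constructor <;> linarith)
  have hM := mul_binomProb_le_binomExp h0 h1 (U := U)
    (f := fun S => Real.exp (-(τ / 2) * (S ∩ A).card)) (fun _ _ => (Real.exp_pos _).le)
    (Real.exp (-(τ / 2) * (q * A.card - τ * (q * N))))
    (P := fun S => ((S ∩ A).card : ℝ) ≤ q * A.card - τ * (q * N))
    (fun S _ hS => Real.exp_le_exp.2 (mul_le_mul_of_nonpos_left hS (by linarith)))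
  have h3 := hM.trans hE
  rw [mul_comm, ← le_div_iff₀ (Real.exp_pos _), ← Real.exp_sub] at h3
  refine h3.trans (Real.exp_le_exp.2 ?_)
  have := mul_le_mul_of_nonneg_left hN (mul_nonneg h0 (sq_nonneg τ))
  nlinarith

end Probability

section Deletion

variable {α : Type*} [DecidableEq α]

/-- The total weight of the sequences of `z` pairwise disjoint subsets of `S`. -/
noncomputable def disjointSeqWeight (w : Finset α → ℝ) : ℕ → Finset α → ℝ
  | 0, _ => 1
  | z + 1, S => ∑ F ∈ S.powerset, w F * disjointSeqWeight w z (S \ F)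

lemma disjointSeqWeight_nonneg {w : Finset α → ℝ} (hw : ∀ F, 0 ≤ w F) (z : ℕ) (S : Finset α) :
    0 ≤ disjointSeqWeight w z S := by
  induction z generalizing S with
  | zero => simp [disjointSeqWeight]
  | succ z ih => exact Finset.sum_nonneg fun F _ => mul_nonneg (hw F) (ih _)

lemma binomExp_disjointSeqWeight_le {w : Finset α → ℝ} (hw : ∀ F, 0 ≤ w F) {q : ℝ} (h0 : 0 ≤ q)
    {M : ℝ} (hM0 : 0 ≤ M) (z : ℕ) {U : Finset α}
    (hM : ∑ F ∈ U.powerset, w F * q ^ F.card ≤ M) :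
    binomExp U q (disjointSeqWeight w z) ≤ M ^ z := by
  induction z generalizing U with
  | zero => simp only [pow_zero]; exact (binomExp_const U q 1).le
  | succ z ih =>
    have h : ∀ S ⊆ U, disjointSeqWeight w (z + 1) S =
        ∑ F ∈ U.powerset, w F * if F ⊆ S then disjointSeqWeight w z (S \ F) else 0 := by
      intro S hS
      rw [disjointSeqWeight]
      simp only [mul_ite, mul_zero]
      rw [← Finset.sum_filter]
      refine Finset.sum_congr ?_ fun _ _ => rfl
      ext F
      simp only [mem_filter, mem_powerset]
      exact ⟨fun h => ⟨h.trans hS, h⟩, fun h => h.2⟩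
    rw [binomExp_congr h, binomExp_sum, pow_succ']
    refine le_trans ?_ (mul_le_mul_of_nonneg_right hM (pow_nonneg hM0 z))
    rw [Finset.sum_mul]
    refine Finset.sum_le_sum fun F hF => ?_
    rw [binomExp_const_mul, binomExp_superset (mem_powerset.1 hF), mul_assoc]
    refine mul_le_mul_of_nonneg_left (mul_le_mul_of_nonneg_left (ih ?_) (pow_nonneg h0 _)) (hw F)
    refine le_trans ?_ hM
    exact Finset.sum_le_sum_of_subset_of_nonneg (powerset_mono.2 sdiff_subset)
      fun _ _ _ => mul_nonneg (hw _) (pow_nonneg h0 _)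

lemma pow_le_disjointSeqWeight {w : Finset α → ℝ} (hw : ∀ F, 0 ≤ w F) {r : ℕ}
    (hr : ∀ F, w F ≠ 0 → F.card ≤ r) {M : ℝ} (hM0 : 0 ≤ M) (z : ℕ) {S : Finset α}
    (hS : ∀ X ⊆ S, X.card ≤ r * z → M ≤ ∑ F ∈ (S \ X).powerset, w F) :
    M ^ z ≤ disjointSeqWeight w z S := by
  induction z generalizing S with
  | zero => simp [disjointSeqWeight]
  | succ z ih =>
    rw [pow_succ', disjointSeqWeight]
    have h := hS ∅ (empty_subset _) (by simp)
    rw [sdiff_empty] at h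
    refine (mul_le_mul_of_nonneg_right h (pow_nonneg hM0 z)).trans ?_
    rw [Finset.sum_mul]
    refine Finset.sum_le_sum fun F hF => ?_
    by_cases hwF : w F = 0
    · simp [hwF]
    refine mul_le_mul_of_nonneg_left (ih fun X hX hXc => ?_) (hw F)
    rw [show (S \ F) \ X = S \ (F ∪ X) from sdiff_sdiff_left]
    exact hS (F ∪ X) (union_subset (mem_powerset.1 hF) (hX.trans sdiff_subset)) (by
      have := card_union_le F X
      have := hr F hwF
      rw [mul_add, mul_one]; omega)

/-- The deletion method: outside an event of exponentially small probability, deleting a small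
set brings a polynomial with nonnegative coefficients below twice its expectation. -/
lemma binomProb_deletion {w : Finset α → ℝ} (hw : ∀ F, 0 ≤ w F) {r : ℕ}
    (hr : ∀ F, w F ≠ 0 → F.card ≤ r) {q : ℝ} (h0 : 0 ≤ q) (h1 : q ≤ 1) {M : ℝ} (hM0 : 0 < M)
    {U : Finset α} (hM : ∑ F ∈ U.powerset, w F * q ^ F.card ≤ M) (z : ℕ) :
    binomProb U q (fun S => ∀ X ⊆ S, X.card ≤ r * z → 2 * M ≤ ∑ F ∈ (S \ X).powerset, w F) ≤
      (1 / 2) ^ z := by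
  have h := (mul_binomProb_le_binomExp h0 h1 (U := U)
    (fun S _ => disjointSeqWeight_nonneg hw z S) ((2 * M) ^ z)
    (fun S _ hS => pow_le_disjointSeqWeight hw hr (by positivity) z hS)).trans
    (binomExp_disjointSeqWeight_le hw h0 hM0.le z hM)
  rw [mul_pow] at h
  rw [one_div, inv_pow, ← one_div, le_div_iff₀ (by positivity)]
  have hp : 0 < M ^ z := by positivity
  refine le_of_mul_le_mul_left ?_ hp
  calc _ = _ := by ring
    _ ≤ _ := h
    _ = _ := by ring

/-- The number of triples `(v, e, e')` with `v ∈ e ∩ e'` and `F ⊆ e ∪ e'` such that both `e` and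
`e'` contain at least `i` elements of `F` other than `v`. -/
noncomputable def pairWeight (V : Finset α) (E : Finset (Finset α)) (i : ℕ) (F : Finset α) : ℝ :=
  ∑ v ∈ V, ∑ e ∈ E, ∑ e' ∈ E,
    if F ⊆ e ∪ e' ∧ (v ∈ e ∧ i ≤ (e ∩ F.erase v).card) ∧ (v ∈ e' ∧ i ≤ (e' ∩ F.erase v).card)
    then 1 else 0

lemma degi_sq (E : Finset (Finset α)) (i : ℕ) (v : α) (S : Finset α) :
    (degi E i v S : ℝ) ^ 2 = ∑ e ∈ E, ∑ e' ∈ E,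
      if (v ∈ e ∧ i ≤ (e ∩ S.erase v).card) ∧ (v ∈ e' ∧ i ≤ (e' ∩ S.erase v).card)
      then 1 else 0 := by
  have : (degi E i v S : ℝ) = ∑ e ∈ E, if v ∈ e ∧ i ≤ (e ∩ S.erase v).card then 1 else 0 := by
    rw [degi, Finset.sum_boole]
  rw [this, sq, Finset.sum_mul_sum]
  refine Finset.sum_congr rfl fun e _ => Finset.sum_congr rfl fun e' _ => ?_
  by_cases h : v ∈ e ∧ i ≤ (e ∩ S.erase v).card <;> simp [h]

lemma sum_pairWeight (V : Finset α) (E : Finset (Finset α)) (i : ℕ) (J : Finset (Finset α)) :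
    ∑ F ∈ J, pairWeight V E i F = ∑ v ∈ V, ∑ e ∈ E, ∑ e' ∈ E, ∑ F ∈ J,
      if F ⊆ e ∪ e' ∧ (v ∈ e ∧ i ≤ (e ∩ F.erase v).card) ∧ (v ∈ e' ∧ i ≤ (e' ∩ F.erase v).card)
      then (1 : ℝ) else 0 := by
  simp only [pairWeight]
  rw [Finset.sum_comm]
  refine Finset.sum_congr rfl fun v _ => ?_
  rw [Finset.sum_comm]
  refine Finset.sum_congr rfl fun e _ => ?_
  rw [Finset.sum_comm]

lemma sum_degi_sq_le (V : Finset α) (E : Finset (Finset α)) (i : ℕ) (S : Finset α) :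
    ∑ v ∈ V, (degi E i v S : ℝ) ^ 2 ≤ ∑ F ∈ S.powerset, pairWeight V E i F := by
  rw [sum_pairWeight]
  simp only [degi_sq]
  refine Finset.sum_le_sum fun v _ => Finset.sum_le_sum fun e _ => Finset.sum_le_sum fun e' _ => ?_
  split_ifs with h
  · refine le_trans ?_ (Finset.single_le_sum (fun F _ => by split_ifs <;> norm_num)
      (mem_powerset.2 (inter_subset_left (s₁ := S) (s₂ := e ∪ e'))))
    have h1 : e ∩ (S ∩ (e ∪ e')).erase v = e ∩ S.erase v := by
      ext x; simp only [mem_inter, mem_erase, mem_union]; tauto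
    have h2 : e' ∩ (S ∩ (e ∪ e')).erase v = e' ∩ S.erase v := by
      ext x; simp only [mem_inter, mem_erase, mem_union]; tauto
    rw [h1, h2, if_pos ⟨inter_subset_right, h⟩]
  · exact Finset.sum_nonneg fun F _ => by split_ifs <;> norm_num

lemma sum_pairWeight_le {k : ℕ} (V : Finset α) {E : Finset (Finset α)}
    (hE : ∀ e ∈ E, e.card = k) (i : ℕ) (S : Finset α) :
    ∑ F ∈ S.powerset, pairWeight V E i F ≤ 4 ^ k * ∑ v ∈ V, (degi E i v S : ℝ) ^ 2 := by
  rw [sum_pairWeight]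
  simp only [degi_sq, Finset.mul_sum]
  refine Finset.sum_le_sum fun v _ => Finset.sum_le_sum fun e he =>
    Finset.sum_le_sum fun e' he' => ?_
  split_ifs with h
  · rw [Finset.sum_boole, mul_one]
    have h1 : (filter (fun F => F ⊆ e ∪ e' ∧ (v ∈ e ∧ i ≤ (e ∩ F.erase v).card) ∧
        (v ∈ e' ∧ i ≤ (e' ∩ F.erase v).card)) S.powerset).card ≤ (e ∪ e').powerset.card := by
      refine card_le_card fun F hF => ?_
      rw [mem_filter] at hF
      exact mem_powerset.2 hF.2.1
    have h2 : (e ∪ e').powerset.card ≤ 4 ^ k := by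
      rw [card_powerset, show 4 = 2 ^ 2 by norm_num, ← pow_mul]
      refine Nat.pow_le_pow_right (by norm_num) ((card_union_le _ _).trans ?_)
      rw [hE e he, hE e' he']; omega
    exact_mod_cast h1.trans h2
  · rw [mul_zero]
    refine (Finset.sum_eq_zero fun F hF => if_neg fun hF' => h ?_).le
    have hs : F.erase v ⊆ S.erase v := erase_subset_erase v (mem_powerset.1 hF)
    exact ⟨⟨hF'.2.1.1, hF'.2.1.2.trans (card_le_card (inter_subset_inter_left hs))⟩,
      ⟨hF'.2.2.1, hF'.2.2.2.trans (card_le_card (inter_subset_inter_left hs))⟩⟩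

lemma sum_pairWeight_mul_pow_le {k : ℕ} {V U : Finset α} (hU : U ⊆ V) {E : Finset (Finset α)}
    (hE : ∀ e ∈ E, e.card = k) (i : ℕ) {q : ℝ} (h0 : 0 ≤ q) (h1 : q ≤ 1) :
    ∑ F ∈ U.powerset, pairWeight V E i F * q ^ F.card ≤ 4 ^ k * mu V E i q := by
  have hw : ∀ F, 0 ≤ pairWeight V E i F := fun F => Finset.sum_nonneg fun _ _ =>
    Finset.sum_nonneg fun _ _ => Finset.sum_nonneg fun _ _ => by split_ifs <;> norm_num
  have hmu : mu V E i q = binomExp V q (fun S => ∑ v ∈ V, (degi E i v S : ℝ) ^ 2) := rfl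
  rw [hmu, ← binomExp_const_mul]
  refine le_trans ?_ (binomExp_mono h0 h1 fun S _ => sum_pairWeight_le V hE i S)
  have h : ∀ S ⊆ V, ∑ F ∈ S.powerset, pairWeight V E i F =
      ∑ F ∈ V.powerset, pairWeight V E i F * if F ⊆ S then 1 else 0 := by
    intro S hS
    simp only [mul_ite, mul_zero, mul_one]
    rw [← Finset.sum_filter]
    refine Finset.sum_congr ?_ fun _ _ => rfl
    ext F
    simp only [mem_filter, mem_powerset]
    exact ⟨fun h => ⟨h.trans hS, h⟩, fun h => h.2⟩
  rw [binomExp_congr h, binomExp_sum]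
  refine (Finset.sum_le_sum_of_subset_of_nonneg (powerset_mono.2 hU)
    fun _ _ _ => mul_nonneg (hw _) (pow_nonneg h0 _)).trans (Finset.sum_le_sum fun F hF => ?_)
  rw [binomExp_const_mul]
  have := binomExp_superset (mem_powerset.1 hF) q (fun _ => 1)
  rw [this, binomExp_const, mul_one]

lemma binomProb_sum_degi_sq_deletion {k : ℕ} {V U : Finset α} (hU : U ⊆ V)
    {E : Finset (Finset α)} (hE : ∀ e ∈ E, e.card = k) (i : ℕ) {q : ℝ} (h0 : 0 ≤ q) (h1 : q ≤ 1)
    {B : ℝ} (hB0 : 0 < B) (hB : mu V E i q ≤ B) (z : ℕ) :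
    binomProb U q (fun S => ∀ X ⊆ S, X.card ≤ 2 * k * z →
      2 * (4 ^ k * B) ≤ ∑ v ∈ V, (degi E i v (S \ X) : ℝ) ^ 2) ≤ (1 / 2) ^ z := by
  have hw : ∀ F, 0 ≤ pairWeight V E i F := fun F => Finset.sum_nonneg fun _ _ =>
    Finset.sum_nonneg fun _ _ => Finset.sum_nonneg fun _ _ => by split_ifs <;> norm_num
  have hr : ∀ F, pairWeight V E i F ≠ 0 → F.card ≤ 2 * k := by
    intro F hF
    obtain ⟨v, -, hv⟩ := Finset.exists_ne_zero_of_sum_ne_zero hF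
    obtain ⟨e, he, hv⟩ := Finset.exists_ne_zero_of_sum_ne_zero hv
    obtain ⟨e', he', hv⟩ := Finset.exists_ne_zero_of_sum_ne_zero hv
    rw [ne_eq, ite_eq_right_iff, Classical.not_imp] at hv
    have := card_le_card hv.1.1
    have := card_union_le e e'
    have := hE e he
    have := hE e' he'
    omega
  refine (binomProb_mono h0 h1 fun S _ h X hX hXc => (h X hX hXc).trans
    (sum_degi_sq_le V E i _)).trans (binomProb_deletion hw hr h0 h1 (by positivity)
    ((sum_pairWeight_mul_pow_le hU hE i h0 h1).trans
      (mul_le_mul_of_nonneg_left hB (by positivity))) z)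

end Deletion

section RichVertices

variable {α : Type*} [DecidableEq α]

lemma sum_card_filter_mem_le {k : ℕ} {E : Finset (Finset α)} (hE : ∀ e ∈ E, e.card = k)
    (A : Finset α) : ∑ v ∈ A, (E.filter (v ∈ ·)).card ≤ k * E.card := by
  simp only [card_filter]
  rw [Finset.sum_comm, mul_comm, ← smul_eq_mul]
  refine Finset.sum_le_card_nsmul _ _ _ fun e he => ?_
  rw [← card_filter, ← hE e he]
  exact card_le_card fun x hx => (mem_filter.1 hx).2

lemma edgeCountIn_mono (E : Finset (Finset α)) {U U' W W' : Finset α} (hU : U ⊆ U')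
    (hW : W ⊆ W') (i : ℕ) : edgeCountIn E U W i ≤ edgeCountIn E U' W' i :=
  card_le_card fun _ he => by
    rw [mem_filter] at he ⊢
    exact ⟨he.1, he.2.1.trans hU, he.2.2.trans (card_le_card (inter_subset_inter_left hW))⟩

/-- The vertices of `U` that lie in at least `t` edges inside `U` meeting `W` in at least `i`
further vertices. -/
noncomputable def richSet (E : Finset (Finset α)) (U W : Finset α) (i : ℕ) (t : ℝ) : Finset α :=
  U.filter fun v => t ≤ (degi (E.filter (· ⊆ U)) i v W : ℝ)

lemma degi_mono {E E' : Finset (Finset α)} (hE : E ⊆ E') (i : ℕ) (v : α) {W W' : Finset α}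
    (hW : W ⊆ W') : degi E i v W ≤ degi E' i v W' :=
  card_le_card fun _ he => by
    rw [mem_filter] at he ⊢
    exact ⟨hE he.1, he.2.1,
      he.2.2.trans (card_le_card (inter_subset_inter_left (erase_subset_erase v hW)))⟩

lemma mul_card_le_edgeCountIn {k : ℕ} {E : Finset (Finset α)} (hE : ∀ e ∈ E, e.card = k)
    {U W₁ A W : Finset α} {i : ℕ} {t : ℝ} (hA : A ⊆ richSet E U W₁ i t) (hW₁ : W₁ ⊆ W)
    (hAW : A ⊆ W) : t * A.card ≤ k * edgeCountIn E U W (i + 1) := by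
  have h1 : t * A.card ≤ ∑ v ∈ A, (degi (E.filter (· ⊆ U)) i v W₁ : ℝ) := by
    rw [mul_comm, ← nsmul_eq_mul]
    exact Finset.card_nsmul_le_sum _ _ _ fun v hv => (mem_filter.1 (hA hv)).2
  have h2 : ∑ v ∈ A, degi (E.filter (· ⊆ U)) i v W₁ ≤ k * edgeCountIn E U W (i + 1) := by
    refine le_trans (Finset.sum_le_sum fun v hv => ?_) (sum_card_filter_mem_le
      (E := E.filter fun e => e ⊆ U ∧ i + 1 ≤ (e ∩ W).card)
      (fun e he => hE e (mem_filter.1 he).1) A)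
    refine card_le_card fun e he => ?_
    simp only [mem_filter] at he ⊢
    refine ⟨⟨he.1.1, he.1.2, he.2.2.trans_lt (card_lt_card ?_)⟩, he.2.1⟩
    refine (ssubset_iff_of_subset (inter_subset_inter_left
      ((erase_subset _ _).trans hW₁))).2 ⟨v, mem_inter.2 ⟨he.2.1, hAW hv⟩, by simp⟩
  exact h1.trans (by exact_mod_cast h2)

lemma edgeCountIn_le_sum_degi {k : ℕ} {E : Finset (Finset α)} (hE : ∀ e ∈ E, e.card = k)
    {i : ℕ} (hik : i < k) (U W : Finset α) :
    edgeCountIn E U W i ≤ ∑ v ∈ U, degi (E.filter (· ⊆ U)) i v W := by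
  simp only [degi, card_filter (p := fun e => _ ∧ _) (s := E.filter _)]
  rw [Finset.sum_comm, edgeCountIn, ← filter_filter, card_filter]
  refine Finset.sum_le_sum fun e he => ?_
  split_ifs with h
  · rw [mem_filter] at he
    obtain ⟨v, hv, hv'⟩ : ∃ v ∈ e, i ≤ (e ∩ W.erase v).card := by
      by_cases hW : e ⊆ W
      · obtain ⟨v, hv⟩ := card_pos.1 (by rw [hE e he.1]; omega : 0 < e.card)
        refine ⟨v, hv, ?_⟩
        rw [inter_erase, inter_eq_left.2 hW, card_erase_of_mem hv, hE e he.1]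
        omega
      · obtain ⟨v, hv, hvW⟩ := not_subset.1 hW
        exact ⟨v, hv, by rwa [erase_eq_of_notMem hvW]⟩
    refine le_trans ?_ (Finset.single_le_sum (fun _ _ => Nat.zero_le _) (he.2 hv))
    rw [if_pos ⟨hv, hv'⟩]
  · exact Nat.zero_le _

/-- A second moment argument: many edges meeting `W` outside a small set and a bound on the sum of
squared degrees force linearly many rich vertices. -/
lemma sq_le_card_richSet {k : ℕ} {E : Finset (Finset α)} (hE : ∀ e ∈ E, e.card = k)
    {i : ℕ} (hik : i < k) {V U W S X : Finset α} (hU : U ⊆ V) (hV : 0 < V.card) (hW : W ⊆ S)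
    {T D : ℝ} (hT0 : 0 ≤ T) (hT : T ≤ edgeCountIn E U (W \ X) i)
    (hD : ∑ v ∈ V, (degi E i v (S \ X) : ℝ) ^ 2 ≤ D) :
    T ^ 2 ≤ 4 * D * (richSet E U W i (T / (2 * V.card))).card := by
  set d : α → ℝ := fun v => (degi (E.filter (· ⊆ U)) i v (W \ X) : ℝ) with hd
  set Z := richSet E U W i (T / (2 * V.card)) with hZ
  have hVpos : (0 : ℝ) < V.card := by exact_mod_cast hV
  have hZU : Z ⊆ U := filter_subset _ _
  have h1 : T ≤ ∑ v ∈ U, d v := by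
    have := edgeCountIn_le_sum_degi hE hik U (W \ X)
    exact hT.trans (by simp only [hd]; exact_mod_cast this)
  have h2 : ∑ v ∈ U \ Z, d v ≤ T / 2 := by
    have h : ∀ v ∈ U \ Z, d v ≤ T / (2 * V.card) := by
      intro v hv
      rw [Finset.mem_sdiff, hZ, richSet, mem_filter, not_and, not_le] at hv
      have h3 : degi (E.filter (· ⊆ U)) i v (W \ X) ≤ degi (E.filter (· ⊆ U)) i v W :=
        degi_mono le_rfl i v sdiff_subset
      have h4 := hv.2 hv.1
      have : d v ≤ (degi (E.filter (· ⊆ U)) i v W : ℝ) := Nat.cast_le.2 h3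
      linarith
    refine (Finset.sum_le_card_nsmul _ _ _ h).trans ?_
    rw [nsmul_eq_mul]
    have hc : ((U \ Z).card : ℝ) ≤ V.card := by
      exact_mod_cast card_le_card (sdiff_subset.trans hU)
    calc ((U \ Z).card : ℝ) * (T / (2 * V.card)) ≤ V.card * (T / (2 * V.card)) := by gcongr
      _ = T / 2 := by field_simp
  have h3 : T / 2 ≤ ∑ v ∈ Z, d v := by
    have := Finset.sum_sdiff (f := d) hZU
    linarith
  have h4 : (∑ v ∈ Z, d v) ^ 2 ≤ Z.card * ∑ v ∈ Z, d v ^ 2 := sq_sum_le_card_mul_sum_sq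
  have h5 : ∑ v ∈ Z, d v ^ 2 ≤ D := by
    refine le_trans ?_ hD
    refine (Finset.sum_le_sum fun v _ => ?_).trans
      (Finset.sum_le_sum_of_subset_of_nonneg (hZU.trans hU) fun _ _ _ => sq_nonneg _)
    have : degi (E.filter (· ⊆ U)) i v (W \ X) ≤ degi E i v (S \ X) :=
      degi_mono (filter_subset _ _) i v (sdiff_subset_sdiff hW le_rfl)
    have : d v ≤ (degi E i v (S \ X) : ℝ) := Nat.cast_le.2 this
    exact pow_le_pow_left₀ (Nat.cast_nonneg _) this 2
  have h6 : (T / 2) ^ 2 ≤ Z.card * D :=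
    (pow_le_pow_left₀ (by linarith) h3 2).trans
      (h4.trans (mul_le_mul_of_nonneg_left h5 (Nat.cast_nonneg _)))
  nlinarith

end RichVertices

section Rounds

variable {α : Type*} [DecidableEq α]

/-- `S` contains a set of at least `m` elements spanning fewer than `t` edges of the hypergraph
induced on `U`, where an edge counts if it has at least `i` vertices in the set. -/
def HasSparseSubset (E : Finset (Finset α)) (U : Finset α) (i : ℕ) (m t : ℝ)
    (S : Finset α) : Prop :=
  ∃ W ⊆ S, m ≤ (W.card : ℝ) ∧ (edgeCountIn E U W i : ℝ) < t

lemma binomProb_hasSparseSubset_one_le {k : ℕ} (hk : 1 ≤ k) {V U : Finset α} (hU : U ⊆ V)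
    (hV : 0 < V.card) {E : Finset (Finset α)} (hE : ∀ e ∈ E, e.card = k) (hE0 : 0 < E.card)
    {a δ ζ : ℝ} (hδ0 : 0 < δ) (hδ1 : δ ≤ 1) (hζ : 0 < ζ)
    (hdense : ∀ A ⊆ V, (a + δ / 2) * (V.card : ℝ) ≤ (A.card : ℝ) →
      ζ * (E.card : ℝ) ≤ ((E.filter fun e => e ⊆ A).card : ℝ))
    {q : ℝ} (h0 : 0 ≤ q) (h1 : q ≤ 1) :
    binomProb U q (HasSparseSubset E U 1 ((a + δ) * (q * V.card))
      (ζ * δ / (8 * k) * q ^ 1 * E.card)) ≤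
      Real.exp (-((δ / 4) ^ 2 / 4 * (q * V.card))) := by
  have hVpos : (0 : ℝ) < V.card := by exact_mod_cast hV
  have hEpos : (0 : ℝ) < E.card := by exact_mod_cast hE0
  have hkpos : (0 : ℝ) < k := by exact_mod_cast hk
  set t : ℝ := ζ / 2 * E.card / V.card with ht
  have htpos : 0 < t := by positivity
  set R := richSet E U ∅ 0 t with hR
  have hRU : R ⊆ U := filter_subset _ _
  have hdeg : ∀ v, degi (E.filter (· ⊆ U)) 0 v ∅ = ((E.filter (· ⊆ U)).filter (v ∈ ·)).card := by
    intro v; simp [degi]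
  set A := U \ R with hA
  have hAU : A ⊆ U := sdiff_subset
  have hAV : (A.card : ℝ) ≤ V.card := by exact_mod_cast card_le_card (hAU.trans hU)
  have hAcard : (A.card : ℝ) < (a + δ / 2) * V.card := by
    by_contra! hcon
    have h2 := hdense A (hAU.trans hU) hcon
    have h3 : (E.filter fun e => e ⊆ A).card ≤
        ∑ v ∈ A, degi (E.filter (· ⊆ U)) 0 v ∅ := by
      simp only [hdeg, card_filter (p := fun e => _ ∈ e)]
      rw [Finset.sum_comm, card_eq_sum_ones]
      refine (Finset.sum_le_sum fun e he => ?_).trans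
        (Finset.sum_le_sum_of_subset (t := E.filter (· ⊆ U)) fun e he => ?_)
      · rw [mem_filter] at he
        obtain ⟨v, hv⟩ := card_pos.1 (by rw [hE e he.1]; omega : 0 < e.card)
        refine le_trans ?_ (Finset.single_le_sum (fun _ _ => Nat.zero_le _) (he.2 hv))
        rw [if_pos hv]
      · rw [mem_filter] at he ⊢
        exact ⟨he.1, he.2.trans hAU⟩
    have h4 : ∑ v ∈ A, (degi (E.filter (· ⊆ U)) 0 v ∅ : ℝ) ≤ A.card * t := by
      rw [← nsmul_eq_mul]
      refine Finset.sum_le_card_nsmul _ _ _ fun v hv => ?_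
      rw [hA, hR, richSet, Finset.mem_sdiff, mem_filter, not_and, not_le] at hv
      exact (hv.2 hv.1).le
    have h5 : ((E.filter fun e => e ⊆ A).card : ℝ) ≤
        ∑ v ∈ A, (degi (E.filter (· ⊆ U)) 0 v ∅ : ℝ) := by exact_mod_cast h3
    have h6 : (A.card : ℝ) * t ≤ V.card * t := by gcongr
    have h7 : V.card * t = ζ / 2 * E.card := by rw [ht]; field_simp
    have h8 : 0 < ζ * E.card := by positivity
    linarith
  refine (binomProb_mono h0 h1 fun S hS hbad => ?_).trans
    (binomProb_upper_tail h0 h1 hAU hAV (τ := δ / 4) (by linarith) (by linarith))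
  obtain ⟨W, hWS, hWc, hWe⟩ := hbad
  by_contra! hcon
  have hWA : ((W ∩ A).card : ℝ) ≤ (S ∩ A).card := by
    exact_mod_cast card_le_card (inter_subset_inter_right hWS)
  have hWR : W \ A ⊆ R := by
    intro v hv
    rw [Finset.mem_sdiff, hA, Finset.mem_sdiff] at hv
    by_contra hvR
    exact hv.2 ⟨hS (hWS hv.1), hvR⟩
  have hsplit : ((W \ A).card : ℝ) + (W ∩ A).card = W.card := by
    exact_mod_cast card_sdiff_add_card_inter W A
  have hqA := mul_le_mul_of_nonneg_left hAcard.le h0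
  have h9 : δ / 4 * (q * V.card) ≤ (W \ A).card := by nlinarith
  have h10 := mul_card_le_edgeCountIn hE (i := 0) hWR (empty_subset W) sdiff_subset
  have h11 : (k : ℝ) * edgeCountIn E U W 1 < k * (ζ * δ / (8 * k) * q ^ 1 * E.card) := by
    gcongr
  have h12 : k * (ζ * δ / (8 * k) * q ^ 1 * E.card) = t * (δ / 4 * (q * V.card)) := by
    rw [ht]; field_simp; ring
  have h13 := mul_le_mul_of_nonneg_left h9 htpos.le
  rw [zero_add] at h10
  linarith

/-- With high probability, every dense subset of the first round has many rich vertices. -/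
lemma binomProb_first_round_le {k : ℕ} {V U : Finset α} (hU : U ⊆ V)
    (hV : 0 < V.card) {E : Finset (Finset α)} (hE : ∀ e ∈ E, e.card = k) (hE0 : 0 < E.card)
    {i : ℕ} (hik : i < k) {a d K ξ ε q : ℝ} (hK : 1 ≤ K) (hξ : 0 < ξ) (h0 : 0 < q) (h1 : q ≤ 1)
    (hmu : mu V E i q ≤ K * q ^ (2 * i) * (E.card : ℝ) ^ 2 / V.card)
    (hbad : binomProb U q (HasSparseSubset E U i ((a + d) * (q * V.card))
      (ξ * q ^ i * E.card)) ≤ ε)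
    {z : ℕ} (hz : (2 * k * z : ℝ) ≤ d * (q * V.card)) :
    binomProb U q (fun S => ¬ ((S.card : ℝ) ≤ 2 * (q * V.card) ∧
      ∀ W ⊆ S, (a + 2 * d) * (q * V.card) ≤ (W.card : ℝ) →
        ξ ^ 2 / (8 * 4 ^ k * K) * V.card ≤
          ((richSet E U W i (ξ * q ^ i * E.card / (2 * V.card))).card : ℝ))) ≤
      Real.exp (-(1 / 4 * (q * V.card))) + (ε + (1 / 2) ^ z) := by
  have hVpos : (0 : ℝ) < V.card := by exact_mod_cast hV
  have hEpos : (0 : ℝ) < E.card := by exact_mod_cast hE0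
  have hKpos : (0 : ℝ) < K := by linarith
  have hUV : (U.card : ℝ) ≤ V.card := by exact_mod_cast card_le_card hU
  have htail := binomProb_upper_tail h0.le h1 (le_refl U) hUV (τ := 1) zero_le_one le_rfl
  rw [one_pow] at htail
  have hdel := binomProb_sum_degi_sq_deletion hU hE i h0.le h1
    (B := K * q ^ (2 * i) * (E.card : ℝ) ^ 2 / V.card) (by positivity) hmu z
  refine le_trans ?_ (add_le_add htail (add_le_add hbad hdel))
  refine le_trans (binomProb_mono h0.le h1 fun S hS hnot => ?_)
    ((binomProb_or_le h0.le h1 U _ _).trans (add_le_add le_rfl (binomProb_or_le h0.le h1 U _ _)))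
  by_contra! hcon
  obtain ⟨hc1, hc2, X, hX, hXz, hXd⟩ := hcon
  refine hnot ⟨?_, fun W hW hWc => ?_⟩
  · rw [inter_eq_left.2 hS] at hc1
    have := mul_le_mul_of_nonneg_left hUV h0.le
    linarith
  · have hXc : (X.card : ℝ) ≤ d * (q * V.card) := by
      refine le_trans ?_ hz
      exact_mod_cast hXz
    have hWX : ((W.card : ℝ)) ≤ (W \ X).card + X.card := by
      exact_mod_cast (card_le_card_sdiff_add_card (s := W) (t := X))
    have hT : ξ * q ^ i * E.card ≤ edgeCountIn E U (W \ X) i := by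
      by_contra! hlt
      exact hc2 ⟨W \ X, sdiff_subset.trans hW, by linarith, hlt⟩
    have h := sq_le_card_richSet hE hik hU hV hW (by positivity) hT hXd.le
    set Z : ℝ := ((richSet E U W i (ξ * q ^ i * E.card / (2 * V.card))).card : ℝ)
    have hcst : 0 < q ^ (2 * i) * (E.card : ℝ) ^ 2 / V.card := by positivity
    have h' : ξ ^ 2 * V.card * (q ^ (2 * i) * (E.card : ℝ) ^ 2 / V.card) ≤
        (8 * 4 ^ k * K) * Z * (q ^ (2 * i) * (E.card : ℝ) ^ 2 / V.card) := by
      calc _ = (ξ * q ^ i * E.card) ^ 2 := by rw [mul_comm 2 i, pow_mul]; field_simp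
        _ ≤ _ := h
        _ = _ := by ring
    have h'' := le_of_mul_le_mul_right h' hcst
    rw [div_mul_eq_mul_div, div_le_iff₀ (by positivity)]
    linarith

/-- In the second round, after a good first round, it is unlikely to extend to a sparse set. -/
lemma binomProb_second_round_le {k : ℕ} {V U S₁ : Finset α} (hU : U ⊆ V) (hV : 0 < V.card)
    {E : Finset (Finset α)} (hE : ∀ e ∈ E, e.card = k)
    {i : ℕ} {a δ δ' κ c η u q q₁ q₂ r t' x ε : ℝ} (h0 : 0 ≤ q) (hq₂0 : 0 ≤ q₂) (hq₂ : q₂ ≤ q)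
    (hq : q ≤ 1) (ha : 0 ≤ a + δ') (hκ : 2 * c + κ ≤ δ - δ') (hq₁ : q₁ = c * q)
    (hUc : (U.card : ℝ) ≤ (η + u) * V.card)
    {m : ℝ} (hr0 : 0 < r) (hS₁ : (S₁.card : ℝ) ≤ 2 * (q₁ * V.card))
    (hrich : ∀ W ⊆ S₁, m ≤ (W.card : ℝ) → η * V.card ≤ ((richSet E U W i r).card : ℝ))
    (hprob : ∀ U' ⊆ V, (U'.card : ℝ) ≤ u * V.card → binomProb U' q₂
      (HasSparseSubset E U' (i + 1) ((a + δ') * (q₂ * V.card)) t') ≤ ε)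
    (hx₁ : x ≤ t') (hx₂ : k * x ≤ r * (κ * (q * V.card))) (hε : 0 ≤ ε) :
    binomProb (U \ S₁) q₂ (fun T => ∃ W ⊆ S₁ ∪ T, (a + δ) * (q * V.card) ≤ (W.card : ℝ) ∧
      m ≤ ((W ∩ S₁).card : ℝ) ∧ (edgeCountIn E U W (i + 1) : ℝ) < x) ≤
      Real.exp (2 * (q₁ * V.card)) * ε := by
  have hVpos : (0 : ℝ) < V.card := by exact_mod_cast hV
  set J := S₁.powerset.filter fun W => m ≤ (W.card : ℝ) with hJ
  let U' : Finset α → Finset α := fun W₁ => (U \ S₁) \ richSet E U W₁ i r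
  have hJc : (J.card : ℝ) ≤ Real.exp (2 * (q₁ * V.card)) := by
    have h1 : J.card ≤ 2 ^ S₁.card := (card_filter_le _ _).trans_eq (card_powerset _)
    have h2 : (J.card : ℝ) ≤ 2 ^ S₁.card := by exact_mod_cast h1
    refine h2.trans (le_trans ?_ (Real.exp_le_exp.2 hS₁))
    rw [← mul_one (S₁.card : ℝ), Real.exp_nat_mul]
    have := Real.add_one_le_exp (1 : ℝ)
    exact pow_le_pow_left₀ (by norm_num) (by linarith) _
  have key : ∀ W₁ ∈ J, binomProb (U \ S₁) q₂ (fun T =>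
      HasSparseSubset E (U' W₁) (i + 1) ((a + δ') * (q₂ * V.card)) t' (T ∩ U' W₁)) ≤ ε := by
    intro W₁ hW₁
    rw [hJ, mem_filter, mem_powerset] at hW₁
    rw [binomProb_inter (sdiff_subset : U' W₁ ⊆ U \ S₁)]
    refine hprob _ (sdiff_subset.trans (sdiff_subset.trans hU)) ?_
    have h1 := hrich W₁ hW₁.1 hW₁.2
    have h2 : richSet E U W₁ i r ⊆ U := filter_subset _ _
    have h3 : (U' W₁).card + (richSet E U W₁ i r).card ≤ U.card := by
      rw [← card_sdiff_add_card_eq_card h2]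
      exact Nat.add_le_add_right (card_le_card (sdiff_subset_sdiff sdiff_subset le_rfl)) _
    have h4 : ((U' W₁).card : ℝ) + (richSet E U W₁ i r).card ≤ U.card := by exact_mod_cast h3
    linarith
  refine le_trans (binomProb_mono hq₂0 (hq₂.trans hq) fun T hT hbad => ?_)
    ((binomProb_exists_le hq₂0 (hq₂.trans hq) J (U \ S₁) _).trans
      ((Finset.sum_le_card_nsmul _ _ _ key).trans ?_))
  · obtain ⟨W, hWST, hWc, hWm, hWe⟩ := hbad
    refine ⟨W ∩ S₁, ?_, ?_⟩
    · rw [hJ, mem_filter, mem_powerset]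
      exact ⟨inter_subset_right, hWm⟩
    set Z := richSet E U (W ∩ S₁) i r with hZ
    have hsplit : ((W \ S₁).card : ℝ) + (W ∩ S₁).card = W.card := by
      exact_mod_cast card_sdiff_add_card_inter W S₁
    have hsplit' : (((W \ S₁) \ Z).card : ℝ) + ((W \ S₁) ∩ Z).card = (W \ S₁).card := by
      exact_mod_cast card_sdiff_add_card_inter (W \ S₁) Z
    have hWS₁ : ((W ∩ S₁).card : ℝ) ≤ S₁.card := by
      exact_mod_cast card_le_card inter_subset_right
    have hZc : (((W \ S₁) ∩ Z).card : ℝ) ≤ κ * (q * V.card) := by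
      by_contra! hlt
      have h1 := mul_card_le_edgeCountIn hE (A := (W \ S₁) ∩ Z) inter_subset_right
        (inter_subset_left : W ∩ S₁ ⊆ W) (inter_subset_left.trans sdiff_subset)
      have h2 := mul_lt_mul_of_pos_left hlt hr0
      have h3 := mul_le_mul_of_nonneg_left hWe.le (Nat.cast_nonneg (α := ℝ) k)
      linarith
    have hT' : W \ S₁ ⊆ T := fun v hv => by
      rw [Finset.mem_sdiff] at hv
      exact (mem_union.1 (hWST hv.1)).resolve_left hv.2
    refine ⟨(W \ S₁) \ Z, subset_inter (sdiff_subset.trans hT')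
      (sdiff_subset_sdiff (hT'.trans hT) le_rfl), ?_, ?_⟩
    · have h4 : (a + δ') * (q₂ * V.card) ≤ (a + δ') * (q * V.card) := by gcongr
      have h5 := mul_le_mul_of_nonneg_right hκ (mul_nonneg h0 hVpos.le)
      rw [hq₁] at hS₁
      nlinarith
    · refine lt_of_le_of_lt ?_ (hWe.trans_le hx₁)
      exact_mod_cast edgeCountIn_mono E (sdiff_subset.trans sdiff_subset)
        (sdiff_subset.trans sdiff_subset) (i + 1)
  · rw [nsmul_eq_mul]
    gcongr

/-- A dense subset of `S` typically meets the first round of a two-round exposure of `S` in the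
expected proportion. -/
lemma half_le_binomProb_inter {S W : Finset α} (hW : W ⊆ S) {a δ d c x : ℝ} (hc0 : 0 ≤ c)
    (hc1 : c ≤ 1) (ha : 0 ≤ a) (hd0 : 0 ≤ d) (hδd : d < δ) (hδ1 : a + δ ≤ 1) (hx : 0 ≤ x)
    (hWc : (a + δ) * x ≤ (W.card : ℝ)) (hlarge : 1 ≤ (δ - d) ^ 2 / 4 * (c * (δ * x))) :
    1 / 2 ≤ binomProb S c (fun S₁ => (a + d) * (c * x) ≤ ((W ∩ S₁).card : ℝ)) := by
  have htail := binomProb_lower_tail hc0 hc1 hW (le_refl (W.card : ℝ)) (τ := δ - d)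
    (by linarith) (by linarith)
  have hWx : δ * x ≤ W.card := le_trans (by gcongr; linarith) hWc
  have h1 : Real.exp (-((δ - d) ^ 2 / 4 * (c * W.card))) ≤ 1 / 2 := by
    have h2 : 1 ≤ (δ - d) ^ 2 / 4 * (c * W.card) := hlarge.trans (by gcongr)
    refine (Real.exp_le_exp.2 (neg_le_neg h2)).trans ?_
    rw [Real.exp_neg, one_div]
    have := Real.add_one_le_exp (1 : ℝ)
    exact inv_anti₀ (by norm_num) (by linarith)
  rw [binomProb_not]
  have h3 : binomProb S c (fun S₁ => ¬ (a + d) * (c * x) ≤ ((W ∩ S₁).card : ℝ)) ≤ 1 / 2 := by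
    refine (binomProb_mono hc0 hc1 fun S₁ _ hlt => ?_).trans (htail.trans h1)
    rw [not_le] at hlt
    rw [inter_comm]
    have h4 : (a + d) * x ≤ (1 - (δ - d)) * W.card := by
      refine le_trans ?_ (mul_le_mul_of_nonneg_left hWc (by linarith))
      have : (δ - d) * (a + δ) * x ≤ (δ - d) * 1 * x := by gcongr
      nlinarith
    have h5 := mul_le_mul_of_nonneg_left h4 hc0
    linarith
  linarith

/-- One step of the multi-round exposure. -/
lemma binomProb_hasSparseSubset_succ_le {k : ℕ} {V U : Finset α} (hU : U ⊆ V) (hV : 0 < V.card)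
    {E : Finset (Finset α)} (hE : ∀ e ∈ E, e.card = k)
    {i : ℕ} {a δ δ' d κ c η u q q₂ r t' x ε ε₁ : ℝ} (h0 : 0 ≤ q) (hq : q ≤ 1)
    (hc0 : 0 ≤ c) (hc1 : c ≤ 1)
    (hq₂0 : 0 ≤ q₂) (hq₂ : q₂ ≤ q) (hq₂c : (1 - c * q) * q₂ = q * (1 - c))
    (ha : 0 ≤ a) (hd0 : 0 ≤ d) (hδ'0 : 0 ≤ δ') (hδd : d < δ) (hδ1 : a + δ ≤ 1)
    (hκ : 2 * c + κ ≤ δ - δ') (hUc : (U.card : ℝ) ≤ (η + u) * V.card) (hr0 : 0 < r)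
    (hfirst : binomProb U (c * q) (fun S => ¬ ((S.card : ℝ) ≤ 2 * (c * q * V.card) ∧
      ∀ W ⊆ S, (a + d) * (c * q * V.card) ≤ (W.card : ℝ) →
        η * V.card ≤ ((richSet E U W i r).card : ℝ))) ≤ ε₁)
    (hprob : ∀ U' ⊆ V, (U'.card : ℝ) ≤ u * V.card → binomProb U' q₂
      (HasSparseSubset E U' (i + 1) ((a + δ') * (q₂ * V.card)) t') ≤ ε)
    (hx₁ : x ≤ t') (hx₂ : k * x ≤ r * (κ * (q * V.card))) (hε : 0 ≤ ε)
    (hlarge : 1 ≤ (δ - d) ^ 2 / 4 * (c * (δ * (q * V.card)))) :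
    binomProb U q (HasSparseSubset E U (i + 1) ((a + δ) * (q * V.card)) x) ≤
      2 * (ε₁ + Real.exp (2 * (c * q * V.card)) * ε) := by
  classical
  have hcq0 : 0 ≤ c * q := mul_nonneg hc0 h0
  have hcq1 : c * q ≤ 1 := mul_le_one₀ hc1 h0 hq
  let bad : Finset α → Finset α → Prop := fun S₁ T =>
    ∃ W ⊆ S₁ ∪ T, (a + δ) * (q * V.card) ≤ (W.card : ℝ) ∧
      (a + d) * (c * q * V.card) ≤ ((W ∩ S₁).card : ℝ) ∧ (edgeCountIn E U W (i + 1) : ℝ) < x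
  have h1 : binomProb U q (HasSparseSubset E U (i + 1) ((a + δ) * (q * V.card)) x) ≤
      2 * binomExp U q (fun S => binomExp S c (fun S₁ => if bad S₁ (S \ S₁) then 1 else 0)) := by
    rw [binomProb_eq_binomExp, ← binomExp_const_mul]
    refine binomExp_mono h0 hq fun S _ => ?_
    split_ifs with hS
    · obtain ⟨W, hWS, hWc, hWe⟩ := hS
      have h2 := half_le_binomProb_inter hWS hc0 hc1 ha hd0 hδd hδ1
        (mul_nonneg h0 (Nat.cast_nonneg _)) hWc hlarge
      have h3 : binomProb S c (fun S₁ => (a + d) * (c * (q * V.card)) ≤ ((W ∩ S₁).card : ℝ)) ≤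
          binomProb S c (fun S₁ => bad S₁ (S \ S₁)) := by
        refine binomProb_mono hc0 hc1 fun S₁ hS₁ h => ⟨W, ?_, hWc, ?_, hWe⟩
        · rwa [union_sdiff_of_subset hS₁]
        · rwa [mul_assoc c q]
      rw [binomProb_eq_binomExp (P := fun S₁ => bad S₁ (S \ S₁))] at h3
      linarith
    · exact mul_nonneg zero_le_two (binomExp_nonneg hc0 hc1 fun S₁ _ => by split_ifs <;> norm_num)
  refine h1.trans (mul_le_mul_of_nonneg_left ?_ zero_le_two)
  rw [binomExp_two_round U rfl hq₂c (fun S₁ T => if bad S₁ T then 1 else 0)]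
  have h4 : Real.exp (2 * (c * q * V.card)) * ε =
      binomExp U (c * q) (fun _ => Real.exp (2 * (c * q * V.card)) * ε) :=
    (binomExp_const _ _ _).symm
  rw [h4]
  refine le_trans ?_ (add_le_add hfirst le_rfl)
  rw [binomProb_eq_binomExp, ← binomExp_add]
  refine binomExp_mono hcq0 hcq1 fun S₁ _ => ?_
  rw [← binomProb_eq_binomExp]
  split_ifs with hgood
  · rw [zero_add]
    exact binomProb_second_round_le hU hV hE h0 hq₂0 hq₂ hq (by linarith) hκ rfl hUc hr0 hgood.1
      hgood.2 hprob hx₁ hx₂ hε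
  · have := binomProb_le_one hq₂0 (hq₂.trans hq) (U \ S₁) (bad S₁)
    have : 0 ≤ Real.exp (2 * (c * q * V.card)) * ε := mul_nonneg (Real.exp_pos _).le hε
    linarith

end Rounds

section Asymptotics

variable {α : Type*}

lemma binomProb_false (U : Finset α) (q : ℝ) {P : Finset α → Prop} (h : ∀ S ⊆ U, ¬ P S) :
    binomProb U q P = 0 :=
  Finset.sum_eq_zero fun S hS => if_neg (h S (mem_powerset.1 hS))

lemma le_mul_card_of_pow_le {k : ℕ} (hk : 1 ≤ k) {V : Finset α} {E : Finset (Finset α)}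
    (hE : ∀ e ∈ E, e.card = k ∧ e ⊆ V) {p L : ℝ} (hp : 0 < p) (hL : 0 < L)
    (h : L ^ k ≤ p ^ k * (E.card : ℝ)) : L ≤ p * V.card ∧ 0 < E.card ∧ 0 < V.card := by
  have hE0 : 0 < E.card := by
    by_contra! h0
    rw [Nat.le_zero.1 h0, Nat.cast_zero, mul_zero] at h
    exact absurd h (not_le.2 (pow_pos hL k))
  refine ⟨?_, hE0, ?_⟩
  · have h1 : E.card ≤ V.card ^ k := by
      refine (card_le_card fun e he => mem_powersetCard.2 ⟨(hE e he).2, (hE e he).1⟩).trans ?_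
      rw [card_powersetCard]
      exact Nat.choose_le_pow _ _
    have h2 : (E.card : ℝ) ≤ (V.card : ℝ) ^ k := by exact_mod_cast h1
    rw [← pow_le_pow_iff_left₀ hL.le (by positivity) (by omega : k ≠ 0), mul_pow]
    exact h.trans (by gcongr)
  · obtain ⟨e, he⟩ := card_pos.1 hE0
    have := card_le_card (hE e he).2
    have := (hE e he).1
    omega

variable [DecidableEq α]

/-- For all sets `U` of at most `u * |V|` vertices, it is exponentially unlikely that `U_q` contains
a subset of size at least `(a + δ) * q * |V|` that meets few edges inside `U` in at least `i`
vertices. -/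
def Transfers (V : ℕ → Finset α) (E : ℕ → Finset (Finset α)) (p : ℕ → ℝ) (a : ℝ) (i : ℕ)
    (u δ ξ : ℝ) : Prop :=
  ∃ b : ℝ, 0 < b ∧ ∃ C : ℝ, 1 ≤ C ∧ ∃ n₀ : ℕ, ∀ n ≥ n₀, ∀ q : ℝ, C * p n ≤ q → q ≤ 1 →
    ∀ U ⊆ V n, (U.card : ℝ) ≤ u * (V n).card →
    binomProb U q (HasSparseSubset (E n) U i ((a + δ) * (q * (V n).card))
      (ξ * q ^ i * (E n).card)) ≤ Real.exp (-(b * (q * (V n).card)))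

lemma failure_sum_le {b b' c d B X Y : ℝ} {k z : ℕ} (hX : 0 ≤ X) (hB : 6 ≤ B * X)
    (hB1 : B ≤ c / 4) (hB2 : B ≤ b * c) (hB3 : B ≤ d * c / (4 * k)) (hB4 : B ≤ b' / 4)
    (hb' : 0 ≤ b') (hc : 8 * c ≤ b') (hY : X / 2 ≤ Y) (hz : d * (c * X) / (2 * k) ≤ z + 1) :
    2 * (Real.exp (-(1 / 4 * (c * X))) + (Real.exp (-(b * (c * X))) + (1 / 2) ^ z) +
      Real.exp (2 * (c * X)) * Real.exp (-(b' * Y))) ≤ Real.exp (-(B / 2 * X)) := by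
  have key : ∀ y, B * X ≤ y → Real.exp (-y) ≤ Real.exp (-(B * X)) :=
    fun y hy => Real.exp_le_exp.2 (neg_le_neg hy)
  have m1 := mul_le_mul_of_nonneg_right hB1 hX
  have m2 := mul_le_mul_of_nonneg_right hB2 hX
  have m3 := mul_le_mul_of_nonneg_right hB3 hX
  have m4 := mul_le_mul_of_nonneg_right hB4 hX
  have m5 := mul_le_mul_of_nonneg_right hc hX
  have m6 := mul_le_mul_of_nonneg_left hY hb'
  have e1 := key (1 / 4 * (c * X)) (by linarith)
  have e2 := key (b * (c * X)) (by linarith)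
  have e4 : Real.exp (2 * (c * X)) * Real.exp (-(b' * Y)) ≤ Real.exp (-(B * X)) := by
    rw [← Real.exp_add]; exact Real.exp_le_exp.2 (by linarith)
  have hexp1 : (2 : ℝ) ≤ Real.exp 1 := by linarith [Real.add_one_le_exp (1 : ℝ)]
  have e3 : (1 / 2 : ℝ) ^ z ≤ 2 * Real.exp (-(B * X)) := by
    have h1 : (1 / 2 : ℝ) ≤ Real.exp (-(1 / 2)) := by
      linarith [Real.add_one_le_exp (-(1 / 2) : ℝ)]
    have h2 : B * X ≤ (z + 1) / 2 := by
      have : d * c / (4 * k) * X = d * (c * X) / (2 * k) / 2 := by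
        rw [div_div, div_mul_eq_mul_div]; congr 1 <;> ring
      linarith
    have h3 : Real.exp (1 / 2) ≤ 2 := by
      rw [← inv_inv (Real.exp _), ← Real.exp_neg]
      exact inv_le_of_inv_le₀ (by norm_num) (by linarith)
    calc (1 / 2 : ℝ) ^ z ≤ Real.exp (-(1 / 2)) ^ z := pow_le_pow_left₀ (by norm_num) h1 z
      _ = Real.exp (z * -(1 / 2)) := (Real.exp_nat_mul _ _).symm
      _ ≤ Real.exp (1 / 2 + -(B * X)) := Real.exp_le_exp.2 (by linarith)
      _ = Real.exp (1 / 2) * Real.exp (-(B * X)) := Real.exp_add _ _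
      _ ≤ _ := by gcongr
  have h3 : 10 * Real.exp (-(B * X)) ≤ Real.exp (-(B / 2 * X)) := by
    have h4 : (10 : ℝ) ≤ Real.exp (B / 2 * X) := by
      refine le_trans ?_ (Real.exp_le_exp.2 (by linarith : 3 ≤ B / 2 * X))
      have h5 : Real.exp 3 = Real.exp 1 ^ 3 := by rw [← Real.exp_nat_mul]; norm_num
      have h6 := pow_le_pow_left₀ (by norm_num) Real.exp_one_gt_d9.le 3
      rw [h5]
      exact le_trans (by norm_num) h6
    calc 10 * Real.exp (-(B * X)) ≤ Real.exp (B / 2 * X) * Real.exp (-(B * X)) := by gcongr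
      _ = _ := by rw [← Real.exp_add]; ring_nf
  have := Real.exp_pos (-(B * X))
  linarith

lemma Transfers.succ_step {k : ℕ} {V : ℕ → Finset α} {E : ℕ → Finset (Finset α)}
    (hunif : ∀ n, ∀ e ∈ E n, e.card = k ∧ e ⊆ V n) {p : ℕ → ℝ} (hp : ∀ n, 0 < p n ∧ p n < 1)
    (hlim : ∀ L : ℝ, ∃ n₀ : ℕ, ∀ n ≥ n₀,
      L ≤ p n * (V n).card ∧ 0 < (E n).card ∧ 0 < (V n).card)
    {a K : ℝ} (ha : 0 ≤ a) (hK : 1 ≤ K) (hbdd : KPBounded k V E K p)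
    {i : ℕ} (hi : 1 ≤ i) (hik : i < k) {d δ δ' ξ ξ' u : ℝ} (hd : 0 < d) (hdδ' : 2 * d < δ')
    (hδ' : δ' < δ) (hδ : a + δ ≤ 1) (hξ : 0 < ξ) (hi₁ : Transfers V E p a i 1 d ξ)
    (hξ' : 0 < ξ') (hu : Transfers V E p a (i + 1) u δ' ξ') :
    ∃ ξ'' : ℝ, 0 < ξ'' ∧
      Transfers V E p a (i + 1) (ξ ^ 2 / (8 * 4 ^ k * K) + u) δ ξ'' := by
  obtain ⟨b, hb, C, hC, n₁, h₁⟩ := hi₁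
  obtain ⟨b', hb', C', hC', n₂, h₂⟩ := hu
  obtain ⟨n₃, h₃⟩ := hbdd i hi (by omega)
  have hkpos : (0 : ℝ) < k := by exact_mod_cast (by omega : 0 < k)
  obtain ⟨c, hc0, hc1, hc2, hc3⟩ : ∃ c : ℝ, 0 < c ∧ c ≤ 1 / 2 ∧ 8 * c ≤ b' ∧
      4 * c ≤ δ - δ' := by
    refine ⟨min (1 / 2) (min (b' / 8) ((δ - δ') / 4)), ?_, min_le_left _ _, ?_, ?_⟩
    · have : 0 < δ - δ' := by linarith
      positivity
    · have := (min_le_right (1 / 2) (min (b' / 8) ((δ - δ') / 4))).trans (min_le_left _ _)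
      linarith
    · have := (min_le_right (1 / 2) (min (b' / 8) ((δ - δ') / 4))).trans (min_le_right _ _)
      linarith
  obtain ⟨B, hB0, hB1, hB2, hB3, hB4⟩ : ∃ B : ℝ, 0 < B ∧ B ≤ c / 4 ∧ B ≤ b * c ∧
      B ≤ d * c / (4 * k) ∧ B ≤ b' / 4 := by
    refine ⟨min (min (c / 4) (b * c)) (min (d * c / (4 * k)) (b' / 4)), by positivity,
      (min_le_left _ _).trans (min_le_left _ _), (min_le_left _ _).trans (min_le_right _ _),
      (min_le_right _ _).trans (min_le_left _ _), (min_le_right _ _).trans (min_le_right _ _)⟩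
  obtain ⟨κ, hκ⟩ : ∃ κ, κ = (δ - δ') / 2 := ⟨_, rfl⟩
  have hκ0 : 0 < κ := by rw [hκ]; linarith
  obtain ⟨ξ'', hξ''0, hξ''1, hξ''2⟩ : ∃ ξ'' : ℝ, 0 < ξ'' ∧ ξ'' ≤ ξ' * (1 / 2) ^ (i + 1) ∧
      ξ'' ≤ ξ * c ^ i * κ / (2 * k) :=
    ⟨min (ξ' * (1 / 2) ^ (i + 1)) (ξ * c ^ i * κ / (2 * k)), by positivity,
      min_le_left _ _, min_le_right _ _⟩
  obtain ⟨n₄, h₄⟩ := hlim (max (6 / B) (4 / ((δ - 2 * d) ^ 2 * (c * δ))))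
  refine ⟨ξ'', hξ''0, B / 2, by positivity, max (2 * C') (C / c),
    le_max_of_le_left (by linarith), max (max n₁ n₂) (max n₃ n₄), fun n hn q hq hq1 U hU hUc => ?_⟩
  simp only [ge_iff_le, max_le_iff] at hn
  obtain ⟨hL, hE0, hV0⟩ := h₄ n hn.2.2
  have hp0 := (hp n).1
  have hVpos : (0 : ℝ) < (V n).card := by exact_mod_cast hV0
  have hEpos : (0 : ℝ) < (E n).card := by exact_mod_cast hE0
  have hqC' : 2 * C' * p n ≤ q := (mul_le_mul_of_nonneg_right (le_max_left _ _) hp0.le).trans hq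
  have hqC : C * p n ≤ c * q := by
    have := (mul_le_mul_of_nonneg_right (le_max_right (2 * C') (C / c)) hp0.le).trans hq
    rw [div_mul_eq_mul_div, div_le_iff₀ hc0] at this
    linarith
  have hpq : p n ≤ q := (le_mul_of_one_le_left hp0.le (by linarith)).trans hqC'
  have hpcq : p n ≤ c * q := (le_mul_of_one_le_left hp0.le hC).trans hqC
  have hq0 : 0 < q := hp0.trans_le hpq
  have hcqq : c * q ≤ 1 / 2 * q := mul_le_mul_of_nonneg_right hc1 hq0.le
  have hcq1 : c * q ≤ 1 := by linarith
  have hcq0 : 0 < c * q := by positivity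
  have hLX := hL.trans (mul_le_mul_of_nonneg_right hpq hVpos.le)
  rw [max_le_iff, div_le_iff₀ hB0] at hLX
  have hδd : 0 < δ - 2 * d := by linarith
  have hδ0 : 0 < δ := by linarith
  have hlarge : 1 ≤ (δ - 2 * d) ^ 2 / 4 * (c * (δ * (q * (V n).card))) := by
    have := hLX.2
    rw [div_le_iff₀ (by positivity)] at this
    linarith
  have h1cq : 0 < 1 - c * q := by linarith
  obtain ⟨q₂, hq₂⟩ : ∃ q₂, q₂ = q * (1 - c) / (1 - c * q) := ⟨_, rfl⟩
  have hq₂c : (1 - c * q) * q₂ = q * (1 - c) := by rw [hq₂]; field_simp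
  have hq₂0 : q / 2 ≤ q₂ := by
    rw [hq₂, le_div_iff₀ h1cq]
    have := mul_nonneg hq0.le hcq0.le
    linarith
  have hq₂q : q₂ ≤ q := by
    rw [hq₂, div_le_iff₀ h1cq]
    have := mul_le_mul_of_nonneg_left hq1 hcq0.le
    linarith
  have hU1 : (U.card : ℝ) ≤ 1 * (V n).card := by
    rw [one_mul]; exact_mod_cast card_le_card hU
  obtain ⟨z, hz⟩ : ∃ z, z = ⌊d * (c * (q * (V n).card)) / (2 * k)⌋₊ := ⟨_, rfl⟩
  have hz1 : (2 * k * z : ℝ) ≤ d * (c * q * (V n).card) := by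
    have : (z : ℝ) ≤ d * (c * (q * (V n).card)) / (2 * k) := by
      rw [hz]; exact Nat.floor_le (by positivity)
    rw [le_div_iff₀ (by positivity)] at this
    linarith
  have hz2 : d * (c * (q * (V n).card)) / (2 * k) ≤ z + 1 := by
    rw [hz]; exact (Nat.lt_floor_add_one _).le
  have hfirst := binomProb_first_round_le hU hV0 (fun e he => (hunif n e he).1) hE0 hik hK hξ
    hcq0 hcq1 (h₃ n hn.2.1 _ hpcq hcq1) (h₁ n hn.1.1 _ hqC hcq1 U hU hU1) hz1
  have hstep := binomProb_hasSparseSubset_succ_le (i := i) (c := c) (κ := κ) (q := q) (q₂ := q₂)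
    (x := ξ'' * q ^ (i + 1) * (E n).card) hU hV0 (fun e he => (hunif n e he).1) hq0.le hq1 hc0.le
    (by linarith) (by linarith) hq₂q hq₂c ha (by linarith : 0 ≤ 2 * d) (by linarith) (by linarith)
    hδ (by linarith) hUc (by positivity) hfirst
    (fun U' hU' hU'c => h₂ n hn.1.2 q₂ (by linarith) (hq₂q.trans hq1) U' hU' hU'c) ?_ ?_
    (Real.exp_pos _).le hlarge
  · refine hstep.trans ?_
    rw [mul_assoc c q]
    exact failure_sum_le (by positivity) (by linarith) hB1 hB2 hB3 hB4 hb'.le hc2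
      (by rw [← div_mul_eq_mul_div]; gcongr) hz2
  · refine mul_le_mul_of_nonneg_right ?_ hEpos.le
    calc ξ'' * q ^ (i + 1) ≤ ξ' * (1 / 2) ^ (i + 1) * q ^ (i + 1) := by gcongr
      _ = ξ' * (q / 2) ^ (i + 1) := by rw [mul_assoc, ← mul_pow]; ring_nf
      _ ≤ ξ' * q₂ ^ (i + 1) := by gcongr
  · calc k * (ξ'' * q ^ (i + 1) * (E n).card)
        ≤ k * (ξ * c ^ i * κ / (2 * k) * q ^ (i + 1) * (E n).card) := by gcongr
      _ = _ := by field_simp; ring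

lemma exists_transfers_succ {k : ℕ} {V : ℕ → Finset α} {E : ℕ → Finset (Finset α)}
    (hunif : ∀ n, ∀ e ∈ E n, e.card = k ∧ e ⊆ V n) {p : ℕ → ℝ} (hp : ∀ n, 0 < p n ∧ p n < 1)
    (hlim : ∀ L : ℝ, ∃ n₀ : ℕ, ∀ n ≥ n₀,
      L ≤ p n * (V n).card ∧ 0 < (E n).card ∧ 0 < (V n).card)
    {a K : ℝ} (ha : 0 ≤ a) (hK : 1 ≤ K) (hbdd : KPBounded k V E K p)
    {i : ℕ} (hi : 1 ≤ i) (hik : i < k) {δ ξ : ℝ} (hδ : 0 < δ) (hδ1 : a + δ ≤ 1) (hξ : 0 < ξ)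
    (hi₁ : Transfers V E p a i 1 (δ / 4) ξ) :
    ∃ ξ' : ℝ, 0 < ξ' ∧ Transfers V E p a (i + 1) 1 δ ξ' := by
  set η := ξ ^ 2 / (8 * 4 ^ k * K) with hη
  have hη0 : 0 < η := by positivity
  have key : ∀ t : ℕ, ∀ δ' : ℝ, δ / 2 < δ' → a + δ' ≤ 1 →
      ∃ ξ' : ℝ, 0 < ξ' ∧ Transfers V E p a (i + 1) (t * η) δ' ξ' := by
    intro t
    induction t with
    | zero =>
      intro δ' hδ' _
      obtain ⟨n₀, h₀⟩ := hlim 0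
      refine ⟨1, one_pos, 1, one_pos, 1, le_rfl, n₀, fun n hn q hq hq1 U hU hUc => ?_⟩
      rw [binomProb_false]
      · exact (Real.exp_pos _).le
      · rintro S hS ⟨W, hWS, hW, -⟩
        have h1 : (W.card : ℝ) ≤ U.card := by exact_mod_cast card_le_card (hWS.trans hS)
        have h2 : (0 : ℝ) < (V n).card := by exact_mod_cast (h₀ n hn).2.2
        have h3 : 0 < q := by linarith [(hp n).1]
        have h4 : 0 < a + δ' := by linarith
        have h5 : 0 < (a + δ') * (q * (V n).card) := by positivity
        simp only [Nat.cast_zero, zero_mul] at hUc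
        linarith
    | succ t ih =>
      intro δ' hδ' hδ'1
      obtain ⟨ξ', hξ', h⟩ := ih ((δ / 2 + δ') / 2) (by linarith) (by linarith)
      have := Transfers.succ_step hunif hp hlim ha hK hbdd hi hik (δ := δ') (by linarith)
        (by linarith) (by linarith) hδ'1 hξ hi₁ hξ' h
      rwa [← hη, show η + t * η = (t + 1 : ℕ) * η by push_cast; ring] at this
  obtain ⟨t, ht⟩ := exists_nat_ge (1 / η)
  obtain ⟨ξ', hξ', b, hb, C, hC, n₀, h⟩ := key t δ (by linarith) hδ1
  refine ⟨ξ', hξ', b, hb, C, hC, n₀, fun n hn q hq hq1 U hU hUc => h n hn q hq hq1 U hU ?_⟩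
  rw [div_le_iff₀ hη0] at ht
  exact hUc.trans (by gcongr)

lemma exists_transfers {k : ℕ} (hk : 1 ≤ k) {V : ℕ → Finset α} {E : ℕ → Finset (Finset α)}
    (hunif : ∀ n, ∀ e ∈ E n, e.card = k ∧ e ⊆ V n) {p : ℕ → ℝ} (hp : ∀ n, 0 < p n ∧ p n < 1)
    (hlim : ∀ L : ℝ, ∃ n₀ : ℕ, ∀ n ≥ n₀,
      L ≤ p n * (V n).card ∧ 0 < (E n).card ∧ 0 < (V n).card)
    {a K : ℝ} (ha : 0 ≤ a) (hK : 1 ≤ K) (hdense : AlphaDense V E a)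
    (hbdd : KPBounded k V E K p) {i : ℕ} (hi : 1 ≤ i) (hik : i ≤ k) {δ : ℝ} (hδ : 0 < δ)
    (hδ1 : a + δ ≤ 1) : ∃ ξ : ℝ, 0 < ξ ∧ Transfers V E p a i 1 δ ξ := by
  induction i, hi using Nat.le_induction generalizing δ with
  | base =>
    obtain ⟨ζ, hζ, n₁, h₁⟩ := hdense (δ / 2) (by linarith)
    obtain ⟨n₂, h₂⟩ := hlim 0
    have hkpos : (0 : ℝ) < k := by exact_mod_cast hk
    refine ⟨ζ * δ / (8 * k), by positivity, (δ / 4) ^ 2 / 4, by positivity, 1, le_rfl, max n₁ n₂,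
      fun n hn q hq hq1 U hU _ => ?_⟩
    simp only [ge_iff_le, max_le_iff] at hn
    exact binomProb_hasSparseSubset_one_le hk hU (h₂ n hn.2).2.2 (fun e he => (hunif n e he).1)
      (h₂ n hn.2).2.1 hδ (by linarith) hζ (h₁ n hn.1) (by linarith [(hp n).1]) hq1
  | succ i hi ih =>
    obtain ⟨ξ, hξ, h⟩ := ih (by omega) (δ := δ / 4) (by linarith) (by linarith)
    exact exists_transfers_succ hunif hp hlim ha hK hbdd hi (by omega) hδ hδ1 hξ h

end Asymptotics

/-- The main lemma: the inductive strengthening of the transference theorem. -/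
theorem main_lemma {α : Type*} [DecidableEq α] (k : ℕ) (hk : 1 ≤ k)
    (V : ℕ → Finset α) (E : ℕ → Finset (Finset α))
    (hunif : ∀ n, ∀ e ∈ E n, e.card = k ∧ e ⊆ V n)
    (p : ℕ → ℝ) (hp : ∀ n, 0 < p n ∧ p n < 1)
    (hpE : Tendsto (fun n => p n ^ k * ((E n).card : ℝ)) atTop atTop)
    (a K : ℝ) (ha : 0 ≤ a) (hK : 1 ≤ K)
    (hdense : AlphaDense V E a) (hbdd : KPBounded k V E K p)
    (i : ℕ) (hi1 : 1 ≤ i) (hik : i ≤ k)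
    (δ : ℝ) (hδ : 0 < δ) (ω : ℕ → ℝ) (hω : Tendsto ω atTop atTop) :
    ∃ ξ : ℝ, 0 < ξ ∧ ∃ b : ℝ, 0 < b ∧ ∃ C : ℝ, 1 ≤ C ∧ ∃ n₀ : ℕ,
      ∀ β γ : ℝ, 0 < β → β ≤ 1 → 0 < γ → γ ≤ 1 → a + δ ≤ β * γ →
      ∀ n ≥ n₀, ∀ q : ℝ, C * p n ≤ q → q ≤ 1 / ω n →
      ∀ U ⊆ V n, β * ((V n).card : ℝ) ≤ (U.card : ℝ) →
      1 - (2 : ℝ) ^ (-(b * q * ((V n).card : ℝ))) ≤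
        binomProb U q (fun S => ∀ W ⊆ S, γ * (S.card : ℝ) ≤ (W.card : ℝ) →
          ξ * q ^ i * ((E n).card : ℝ) ≤ (edgeCountIn (E n) U W i : ℝ)) := by
  by_cases hδ1 : a + δ ≤ 1
  swap
  · exact ⟨1, one_pos, 1, one_pos, 1, le_rfl, 0, fun β γ _ hβ hγ0 hγ h =>
      absurd (h.trans (mul_le_one₀ hβ hγ0.le hγ)) hδ1⟩
  have hlim : ∀ L : ℝ, ∃ n₀ : ℕ, ∀ n ≥ n₀,
      L ≤ p n * (V n).card ∧ 0 < (E n).card ∧ 0 < (V n).card := by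
    intro L
    obtain ⟨n₀, h₀⟩ := eventually_atTop.1 (hpE.eventually_ge_atTop (max L 1 ^ k))
    refine ⟨n₀, fun n hn => ?_⟩
    obtain ⟨h, hE⟩ := le_mul_card_of_pow_le hk (hunif n) (hp n).1
      (lt_max_of_lt_right one_pos) (h₀ n hn)
    exact ⟨(le_max_left _ _).trans h, hE⟩
  obtain ⟨ξ, hξ, b, hb, C, hC, n₁, h₁⟩ := exists_transfers hk hunif hp hlim ha hK hdense hbdd
    hi1 hik (δ := δ / 2) (by linarith) (by linarith)
  obtain ⟨B, hB0, hBb, hBδ⟩ : ∃ B : ℝ, 0 < B ∧ B ≤ b ∧ B ≤ (δ / 2) ^ 2 / 4 :=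
    ⟨min b ((δ / 2) ^ 2 / 4), by positivity, min_le_left _ _, min_le_right _ _⟩
  obtain ⟨n₂, h₂⟩ := hlim (2 / B)
  obtain ⟨n₃, h₃⟩ := eventually_atTop.1 (hω.eventually_ge_atTop 1)
  refine ⟨ξ, hξ, B / 2, by positivity, C, hC, max n₁ (max n₂ n₃),
    fun β γ hβ0 hβ hγ0 hγ hβγ n hn q hCq hqω U hU hUβ => ?_⟩
  simp only [ge_iff_le, max_le_iff] at hn
  have hp0 := (hp n).1
  have hpq : p n ≤ q := (le_mul_of_one_le_left hp0.le hC).trans hCq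
  have hq0 : 0 < q := hp0.trans_le hpq
  have hq1 : q ≤ 1 := hqω.trans (div_le_one_of_le₀ (h₃ n hn.2.2) (by linarith [h₃ n hn.2.2]))
  obtain ⟨X, hX⟩ : ∃ X, X = q * ((V n).card : ℝ) := ⟨_, rfl⟩
  have hX0 : 0 ≤ X := by rw [hX]; positivity
  have hBX : 2 ≤ B * X := by
    have := (h₂ n hn.2.1).1.trans (mul_le_mul_of_nonneg_right hpq (Nat.cast_nonneg _))
    rw [div_le_iff₀ hB0, ← hX] at this
    linarith
  have hUV : (U.card : ℝ) ≤ (V n).card := by exact_mod_cast card_le_card hU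
  have htail := binomProb_lower_tail hq0.le hq1 (subset_refl U) hUV
    (by positivity : 0 ≤ δ / 2) (by linarith)
  have hsparse := h₁ n hn.1 q hCq hq1 U hU (by rwa [one_mul])
  rw [← hX] at htail hsparse
  have hfail : binomProb U q (fun S => ¬ ∀ W ⊆ S, γ * (S.card : ℝ) ≤ (W.card : ℝ) →
      ξ * q ^ i * ((E n).card : ℝ) ≤ (edgeCountIn (E n) U W i : ℝ)) ≤
      Real.exp (-((δ / 2) ^ 2 / 4 * X)) + Real.exp (-(b * X)) := by
    refine (binomProb_mono hq0.le hq1 fun S hS h => ?_).trans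
      ((binomProb_or_le hq0.le hq1 U _ _).trans (add_le_add htail hsparse))
    by_contra hcon
    obtain ⟨hcard, hdenseS⟩ := not_or.1 hcon
    rw [inter_eq_left.2 hS, not_le] at hcard
    refine h fun W hW hγW => le_of_not_gt fun hlt => hdenseS ⟨W, hW, ?_, hlt⟩
    have e1 := mul_le_mul_of_nonneg_left hcard.le hγ0.le
    have e2 := mul_le_mul_of_nonneg_left hUβ (mul_nonneg hγ0.le hq0.le)
    have e3 : γ * q * (β * (V n).card) = β * γ * X := by rw [hX]; ring
    have e4 := mul_le_mul_of_nonneg_right hβγ hX0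
    have e5 := mul_le_mul_of_nonneg_right hγ (by positivity : 0 ≤ δ / 2 * X)
    linarith
  rw [binomProb_not]
  have g1 : Real.exp (-((δ / 2) ^ 2 / 4 * X)) ≤ Real.exp (-(B * X)) := by gcongr
  have g2 : Real.exp (-(b * X)) ≤ Real.exp (-(B * X)) := by gcongr
  have g3 : 2 * Real.exp (-(B * X)) ≤ Real.exp (-(B / 2 * X)) := by
    have h2 : 2 ≤ Real.exp (B / 2 * X) := by linarith [Real.add_one_le_exp (B / 2 * X)]
    calc 2 * Real.exp (-(B * X)) ≤ Real.exp (B / 2 * X) * Real.exp (-(B * X)) := by gcongr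
      _ = _ := by rw [← Real.exp_add]; ring_nf
  have g4 : Real.exp (-(B / 2 * X)) ≤ 2 ^ (-(B / 2 * q * (V n).card)) := by
    rw [Real.rpow_def_of_pos two_pos, Real.exp_le_exp, mul_assoc, ← hX]
    have := mul_le_mul_of_nonneg_right (by linarith [Real.log_two_lt_d9] : Real.log 2 ≤ 1)
      (by positivity : 0 ≤ B / 2 * X)
    linarith
  linarith
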